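/- arXiv:1901.01176 — 4 statements merged into one kernel-verified Lean document; each statement's English description precedes it below -/
import Mathlib

section
/- Let n ≥ 1, let b ∈ EuclideanSpace ℝ n with ‖b‖ < 1, and define the Randers norm F(y) = ‖y‖ + ⟪b, y⟫. Then for every y ≠ 0 and every u ≠ 0, the fundamental tensor is positive: (1/2) · (the second derivative at s = 0 of the function s ↦ F(y + s • u)²) > 0. -/
open RealInnerProductSpace

section Randers

variable {E : Type*} [NormedAddCommGroup E] [InnerProductSpace ℝ E]

lemma hasDerivAt_add_smul (y u : E) (s : ℝ) : HasDerivAt (fun t : ℝ => y + t • u) u s := by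
  simpa using ((hasDerivAt_id s).smul_const u).const_add y

lemma hasDerivAt_norm_add_smul {y u : E} {s : ℝ} (h : y + s • u ≠ 0) :
    HasDerivAt (fun t : ℝ => ‖y + t • u‖) (⟪y + s • u, u⟫ / ‖y + s • u‖) s := by
  have hn : ‖y + s • u‖ ^ 2 ≠ 0 := by simpa using h
  have h1 := (hasDerivAt_add_smul y u s).norm_sq.sqrt hn
  simp only [Real.sqrt_sq (norm_nonneg _)] at h1
  convert h1 using 1
  rw [mul_div_mul_left _ _ two_ne_zero]

lemma hasDerivAt_inner_add_smul (b y u : E) (s : ℝ) :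
    HasDerivAt (fun t : ℝ => ⟪b, y + t • u⟫) ⟪b, u⟫ s := by
  simpa using (hasDerivAt_const s b).inner ℝ (hasDerivAt_add_smul y u s)

lemma randers_pos {b y : E} (hb : ‖b‖ < 1) (hy : y ≠ 0) : 0 < ‖y‖ + ⟪b, y⟫ := by
  have hr : 0 < ‖y‖ := norm_pos_iff.2 hy
  have h := (abs_le.1 (abs_real_inner_le_norm b y)).1
  nlinarith

lemma iteratedDeriv_two_randers_sq (b u : E) {y : E} (hy : y ≠ 0) :
    iteratedDeriv 2 (fun s : ℝ => (‖y + s • u‖ + ⟪b, y + s • u⟫) ^ 2) 0 =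
      2 * ((⟪y, u⟫ / ‖y‖ + ⟪b, u⟫) ^ 2 +
        (‖y‖ + ⟪b, y⟫) * ((‖u‖ ^ 2 * ‖y‖ - ⟪y, u⟫ * (⟪y, u⟫ / ‖y‖)) / ‖y‖ ^ 2)) := by
  have hr : ‖y‖ ≠ 0 := norm_ne_zero_iff.2 hy
  have hF {s : ℝ} (hs : y + s • u ≠ 0) :=
    (hasDerivAt_norm_add_smul hs).add (hasDerivAt_inner_add_smul b y u s)
  have hev : ∀ᶠ s : ℝ in nhds 0, y + s • u ≠ 0 :=
    (hasDerivAt_add_smul y u 0).continuousAt.eventually_ne (by simpa using hy)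
  have hderiv : deriv (fun s : ℝ => (‖y + s • u‖ + ⟪b, y + s • u⟫) ^ 2) =ᶠ[nhds 0]
      fun s => 2 * ((‖y + s • u‖ + ⟪b, y + s • u⟫) *
        (⟪y + s • u, u⟫ / ‖y + s • u‖ + ⟪b, u⟫)) := by
    filter_upwards [hev] with s hs
    refine (((hF hs).pow 2).deriv).trans ?_
    simp [mul_assoc]
  rw [iteratedDeriv_succ, iteratedDeriv_one, hderiv.deriv_eq]
  have h0 : y + (0 : ℝ) • u ≠ 0 := by simpa using hy
  have hinner : HasDerivAt (fun t : ℝ => ⟪y + t • u, u⟫) (‖u‖ ^ 2) 0 := by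
    simpa [real_inner_comm] using hasDerivAt_inner_add_smul u y u 0
  have hquot := (hinner.div (hasDerivAt_norm_add_smul h0) (norm_ne_zero_iff.2 h0)).add_const ⟪b, u⟫
  refine (((hF h0).mul hquot).const_mul 2).deriv.trans ?_
  simp
  ring

lemma randers_fundamental_tensor_formula_pos {b y u : E} (hb : ‖b‖ < 1) (hy : y ≠ 0)
    (hu : u ≠ 0) :
    0 < (⟪y, u⟫ / ‖y‖ + ⟪b, u⟫) ^ 2 +
      (‖y‖ + ⟪b, y⟫) * ((‖u‖ ^ 2 * ‖y‖ - ⟪y, u⟫ * (⟪y, u⟫ / ‖y‖)) / ‖y‖ ^ 2) := by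
  have hr : 0 < ‖y‖ := norm_pos_iff.2 hy
  have hF := randers_pos hb hy
  set w : E := ‖y‖ ^ 2 • u - ⟪y, u⟫ • y with hw
  have hsq : ‖w‖ ^ 2 = ‖y‖ ^ 2 * (‖u‖ ^ 2 * ‖y‖ ^ 2 - ⟪y, u⟫ ^ 2) := by
    rw [hw, norm_sub_sq_real, real_inner_smul_left, real_inner_smul_right, norm_smul, norm_smul,
      mul_pow, mul_pow, real_inner_comm y u]
    simp only [Real.norm_eq_abs, sq_abs]
    ring
  have hsecond : (‖u‖ ^ 2 * ‖y‖ - ⟪y, u⟫ * (⟪y, u⟫ / ‖y‖)) / ‖y‖ ^ 2 = ‖w‖ ^ 2 / ‖y‖ ^ 5 := by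
    rw [hsq]
    field_simp
  rw [hsecond]
  by_cases h : w = 0
  · have hsmul : ‖y‖ ^ 2 • u = ⟪y, u⟫ • y := sub_eq_zero.1 h
    have hp : ⟪y, u⟫ ≠ 0 := by
      intro hp
      simp [hp, hy, hu] at hsmul
    have hbu : ‖y‖ ^ 2 * ⟪b, u⟫ = ⟪y, u⟫ * ⟪b, y⟫ := by
      rw [← real_inner_smul_right, hsmul, real_inner_smul_right]
    have hfirst : ⟪y, u⟫ / ‖y‖ + ⟪b, u⟫ = ⟪y, u⟫ * (‖y‖ + ⟪b, y⟫) / ‖y‖ ^ 2 := by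
      field_simp
      linarith
    rw [hfirst, h]
    have := hF.ne'
    simp only [norm_zero]
    positivity
  · have : 0 < ‖w‖ := norm_pos_iff.2 h
    positivity

end Randers

/-- For the Randers norm `F y = ‖y‖ + ⟪b, y⟫` on `EuclideanSpace ℝ (Fin n)`
with `‖b‖ < 1`, the fundamental tensor `g_y(u,u)` is positive for all `y ≠ 0`, `u ≠ 0`. -/
theorem randers_fundamental_tensor_pos
    (n : ℕ) (hn : 1 ≤ n)
    (b : EuclideanSpace ℝ (Fin n)) (hb : ‖b‖ < 1)
    (F : EuclideanSpace ℝ (Fin n) → ℝ)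
    (hF : ∀ y, F y = ‖y‖ + ⟪b, y⟫)
    (y u : EuclideanSpace ℝ (Fin n)) (hy : y ≠ 0) (hu : u ≠ 0) :
    0 < (1 / 2 : ℝ) * iteratedDeriv 2 (fun s : ℝ => (F (y + s • u)) ^ 2) 0 := by
  simp only [hF]
  rw [iteratedDeriv_two_randers_sq b u hy]
  linarith [randers_fundamental_tensor_formula_pos hb hy hu]
end

section
/- Let n ≥ 1 and W ∈ EuclideanSpace ℝ n with ‖W‖ < 1, and let F be the Zermelo–Randers norm with wind W. Then for every y ≠ 0 and every u ∈ EuclideanSpace ℝ n: (1/2) · (the derivative at s = 0 of the function s ↦ F(y + s • u)²) = 0 if and only if ⟪u, y / F(y) − W⟫ = 0. -/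
open RealInnerProductSpace

/-- The Zermelo–Randers norm with wind `W`:
`F(y) = (√(⟪W,y⟫² + λ‖y‖²) − ⟪W,y⟫)/λ` with `λ = 1 − ‖W‖²`.
(The formula also gives `F 0 = 0`.) -/
noncomputable def zermeloRanders {n : ℕ} (W : EuclideanSpace ℝ (Fin n))
    (y : EuclideanSpace ℝ (Fin n)) : ℝ :=
  (Real.sqrt (⟪W, y⟫ ^ 2 + (1 - ‖W‖ ^ 2) * ‖y‖ ^ 2) - ⟪W, y⟫) / (1 - ‖W‖ ^ 2)

section

variable {n : ℕ} {W y : EuclideanSpace ℝ (Fin n)}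

theorem one_sub_norm_sq_pos (hW : ‖W‖ < 1) : 0 < 1 - ‖W‖ ^ 2 := by
  nlinarith [norm_nonneg W]

theorem zermeloRanders_radicand_pos (hW : ‖W‖ < 1) (hy : y ≠ 0) :
    0 < ⟪W, y⟫ ^ 2 + (1 - ‖W‖ ^ 2) * ‖y‖ ^ 2 := by
  have := one_sub_norm_sq_pos hW
  have := norm_pos_iff.mpr hy
  positivity

theorem zermeloRanders_pos (hW : ‖W‖ < 1) (hy : y ≠ 0) : 0 < zermeloRanders W y := by
  have hl := one_sub_norm_sq_pos hW
  have := norm_pos_iff.mpr hy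
  refine div_pos (sub_pos.mpr (Real.lt_sqrt_of_sq_lt ?_)) hl
  exact lt_add_of_pos_right _ (by positivity)

/-- The directional derivative of the Zermelo–Randers norm at `y ≠ 0`. -/
theorem hasDerivAt_zermeloRanders_line (hW : ‖W‖ < 1) (hy : y ≠ 0)
    (u : EuclideanSpace ℝ (Fin n)) :
    HasDerivAt (fun s : ℝ => zermeloRanders W (y + s • u))
      ((⟪u, y⟫ - zermeloRanders W y * ⟪u, W⟫) /
        √(⟪W, y⟫ ^ 2 + (1 - ‖W‖ ^ 2) * ‖y‖ ^ 2)) 0 := by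
  have hl := one_sub_norm_sq_pos hW
  have hR := zermeloRanders_radicand_pos hW hy
  have hline : HasDerivAt (fun s : ℝ => y + s • u) u 0 := by
    simpa using ((hasDerivAt_id (0 : ℝ)).smul_const u).const_add y
  have hinner : HasDerivAt (fun s : ℝ => ⟪W, y + s • u⟫) ⟪W, u⟫ 0 := by
    simpa using (hasDerivAt_const (0 : ℝ) W).inner ℝ hline
  have hnorm : HasDerivAt (fun s : ℝ => ‖y + s • u‖ ^ 2) (2 * ⟪y, u⟫) 0 := by
    simpa using hline.norm_sq
  have hsqrt := ((hinner.fun_pow 2).fun_add (hnorm.const_mul (1 - ‖W‖ ^ 2))).sqrt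
    (by simpa using hR.ne')
  have hF := (hsqrt.fun_sub hinner).div_const (1 - ‖W‖ ^ 2)
  refine hF.congr_deriv ?_
  have hS := (Real.sqrt_pos.mpr hR).ne'
  have hl' := hl.ne'
  simp only [zero_smul, add_zero, zermeloRanders]
  generalize √(⟪W, y⟫ ^ 2 + (1 - ‖W‖ ^ 2) * ‖y‖ ^ 2) = S at *
  rw [real_inner_comm y u, real_inner_comm W u]
  field_simp
  ring

end

/-- For the Zermelo–Randers norm `F` with wind `W`, `‖W‖ < 1`, and all
`y ≠ 0`, `u ≠ 0`: `g_y(y,u) = (1/2)·d/ds|₀ F(y + s•u)² = 0` iff `⟪u, y/F(y) − W⟫ = 0`. -/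
theorem zermelo_finsler_orthogonality
    (n : ℕ) (hn : 1 ≤ n)
    (W : EuclideanSpace ℝ (Fin n)) (hW : ‖W‖ < 1)
    (y u : EuclideanSpace ℝ (Fin n)) (hy : y ≠ 0) (hu : u ≠ 0) :
    (1 / 2 : ℝ) * deriv (fun s : ℝ => (zermeloRanders W (y + s • u)) ^ 2) 0 = 0 ↔
      ⟪u, (zermeloRanders W y)⁻¹ • y - W⟫ = 0 := by
  have hF := zermeloRanders_pos hW hy
  have hS := Real.sqrt_pos.mpr (zermeloRanders_radicand_pos hW hy)
  have hd := (hasDerivAt_zermeloRanders_line hW hy u).fun_pow 2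
  simp only [zero_smul, add_zero] at hd
  have hr : ⟪u, (zermeloRanders W y)⁻¹ • y - W⟫ =
      (zermeloRanders W y)⁻¹ * (⟪u, y⟫ - zermeloRanders W y * ⟪u, W⟫) := by
    rw [inner_sub_right, real_inner_smul_right]
    field_simp
  rw [hd.deriv, hr]
  simp [hF.ne', hS.ne']
end

section
/- Let a ∈ ℝ, p, V ∈ ℝ², and define γ : ℝ → ℝ² by γ(t) = R_{at}(p + t•V), where R_θ is the Euclidean rotation by angle θ. Then γ is differentiable and for every t: γ'(t) − W(γ(t)) = R_{at}(V), where W(x₁,x₂) = a•(−x₂, x₁) is the rigid-rotation Zermelo wind; consequently ‖γ'(t) − W(γ(t))‖ = ‖V‖. -/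
/-- The point of the Euclidean plane `EuclideanSpace ℝ (Fin 2)` with coordinates `(x, y)`. -/
noncomputable def vec2 (x y : ℝ) : EuclideanSpace ℝ (Fin 2) :=
  (WithLp.equiv 2 (Fin 2 → ℝ)).symm ![x, y]

/-- Euclidean rotation of the plane by angle `θ`:
`R_θ(x₁,x₂) = (x₁cos θ − x₂sin θ, x₁sin θ + x₂cos θ)`. -/
noncomputable def Rot (θ : ℝ) (x : EuclideanSpace ℝ (Fin 2)) : EuclideanSpace ℝ (Fin 2) :=
  vec2 (x 0 * Real.cos θ - x 1 * Real.sin θ) (x 0 * Real.sin θ + x 1 * Real.cos θ)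

/-- The rigid-rotation Zermelo wind with angular velocity `a`: `W(x₁,x₂) = a•(−x₂,x₁)`. -/
noncomputable def rigidWind (a : ℝ) (x : EuclideanSpace ℝ (Fin 2)) : EuclideanSpace ℝ (Fin 2) :=
  a • vec2 (-(x 1)) (x 0)

@[simp]
theorem vec2_apply_zero (x y : ℝ) : vec2 x y 0 = x := rfl

@[simp]
theorem vec2_apply_one (x y : ℝ) : vec2 x y 1 = y := rfl

theorem hasDerivAt_vec2 {f g : ℝ → ℝ} {f' g' t : ℝ} (hf : HasDerivAt f f' t)
    (hg : HasDerivAt g g' t) : HasDerivAt (fun s => vec2 (f s) (g s)) (vec2 f' g') t := by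
  rw [← hasDerivWithinAt_univ, hasDerivWithinAt_iff_hasFDerivWithinAt,
    hasFDerivWithinAt_euclidean]
  intro i
  fin_cases i
  · exact (hf.hasFDerivAt.congr_fderiv (by ext; simp)).hasFDerivWithinAt
  · exact (hg.hasFDerivAt.congr_fderiv (by ext; simp)).hasFDerivWithinAt

theorem norm_Rot (θ : ℝ) (x : EuclideanSpace ℝ (Fin 2)) : ‖Rot θ x‖ = ‖x‖ := by
  simp only [EuclideanSpace.norm_eq, Fin.sum_univ_two, Real.norm_eq_abs, sq_abs, Rot,
    vec2_apply_zero, vec2_apply_one]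
  congr 1
  linear_combination (x 0 ^ 2 + x 1 ^ 2) * Real.sin_sq_add_cos_sq θ

/-- The velocity of the rotated line is the wind plus the rotated velocity of the line. -/
theorem hasDerivAt_Rot_line (a : ℝ) (p V : EuclideanSpace ℝ (Fin 2)) (t : ℝ) :
    HasDerivAt (fun s : ℝ => Rot (a * s) (p + s • V))
      (rigidWind a (Rot (a * t) (p + t • V)) + Rot (a * t) V) t := by
  have hlin (i : Fin 2) : HasDerivAt (fun s : ℝ => (p + s • V) i) (V i) t := by
    simpa using ((hasDerivAt_id t).mul_const (V i)).const_add (p i)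
  have harg : HasDerivAt (fun s : ℝ => a * s) a t := by
    simpa using (hasDerivAt_id t).const_mul a
  have hcos := harg.cos
  have hsin := harg.sin
  refine (hasDerivAt_vec2 (((hlin 0).mul hcos).sub ((hlin 1).mul hsin))
    (((hlin 0).mul hsin).add ((hlin 1).mul hcos))).congr_deriv ?_
  ext i
  fin_cases i <;> simp [Rot, rigidWind] <;> ring

/-- Zermelo navigation with a Killing wind. The curve
`γ(t) = R_{at}(p + t•V)` is differentiable and satisfies
`γ'(t) − W(γ(t)) = R_{at}(V)` for all `t`, where `W` is the rigid-rotation Zermelo wind;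
consequently `‖γ'(t) − W(γ(t))‖ = ‖V‖`. -/
theorem rigid_rotation_zermelo_geodesic
    (a : ℝ) (p V : EuclideanSpace ℝ (Fin 2))
    (γ : ℝ → EuclideanSpace ℝ (Fin 2))
    (hγ : ∀ t, γ t = Rot (a * t) (p + t • V)) :
    Differentiable ℝ γ ∧ ∀ t : ℝ,
      deriv γ t - rigidWind a (γ t) = Rot (a * t) V ∧
      ‖deriv γ t - rigidWind a (γ t)‖ = ‖V‖ := by
  obtain rfl : γ = fun t => Rot (a * t) (p + t • V) := funext hγ
  refine ⟨fun t => (hasDerivAt_Rot_line a p V t).differentiableAt, fun t => ?_⟩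
  have h : deriv (fun s : ℝ => Rot (a * s) (p + s • V)) t
      - rigidWind a (Rot (a * t) (p + t • V)) = Rot (a * t) V := by
    rw [(hasDerivAt_Rot_line a p V t).deriv, add_sub_cancel_left]
  exact ⟨h, by rw [h, norm_Rot]⟩
end

section
/- Let n ≥ 1, let v ∈ EuclideanSpace ℝ n and c ∈ ℝ with c > ‖v‖, and let y ∈ EuclideanSpace ℝ n with y ≠ 0. Then T := (√((c² − ‖v‖²)·‖y‖² + ⟪v,y⟫²) + ⟪v,y⟫)/(c² − ‖v‖²) is the unique positive real number satisfying c²·T² = ‖y + T • v‖². Hence the travel time dt of a null ray with spatial displacement y in the stationary acoustic metric ds² = −c²dt² + ‖dx + v·dt‖² is given by the Randers expression dt = √(a(y,y)) + b(y), with a(y,y) = ((c² − ‖v‖²)‖y‖² + ⟪v,y⟫²)/(c² − ‖v‖²)² and b(y) = ⟪v,y⟫/(c² − ‖v‖²). -/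
open RealInnerProductSpace

/-- The positive solution of `k * t ^ 2 = q + 2 * b * t`, for `k` and `q` positive, is
`(√(k * q + b ^ 2) + b) / k`. -/
theorem pos_and_quadratic_iff_eq {k q b t : ℝ} (hk : 0 < k) (hq : 0 < q) :
    (0 < t ∧ k * t ^ 2 = q + 2 * b * t) ↔ t = (√(k * q + b ^ 2) + b) / k := by
  have hkq : 0 < k * q := mul_pos hk hq
  have hb : |b| < √(k * q + b ^ 2) := Real.lt_sqrt_of_sq_lt (by rw [sq_abs]; linarith)
  rw [eq_div_iff hk.ne']
  constructor
  · rintro ⟨ht, h⟩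
    have hbt : 0 ≤ t * k - b := by
      have : t * (t * k - b) = q + b * t := by linarith
      by_contra! hneg
      nlinarith [mul_pos ht hk]
    have hsqrt : √(k * q + b ^ 2) = t * k - b := by
      rw [show k * q + b ^ 2 = (t * k - b) ^ 2 by linear_combination -k * h, Real.sqrt_sq hbt]
    linarith
  · intro h
    have hsq : √(k * q + b ^ 2) ^ 2 = k * q + b ^ 2 := Real.sq_sqrt (by positivity)
    refine ⟨pos_of_mul_pos_left (by linarith [neg_abs_le b]) hk.le, mul_left_cancel₀ hk.ne' ?_⟩
    rw [show √(k * q + b ^ 2) = t * k - b by linarith] at hsq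
    linear_combination hsq

/-- The null condition for the displacement `y` in a flow of velocity `v` is a quadratic
equation in the travel time. -/
theorem sq_mul_sq_eq_norm_add_smul_sq_iff {E : Type*} [NormedAddCommGroup E]
    [InnerProductSpace ℝ E] (v y : E) (c t : ℝ) :
    c ^ 2 * t ^ 2 = ‖y + t • v‖ ^ 2 ↔
      (c ^ 2 - ‖v‖ ^ 2) * t ^ 2 = ‖y‖ ^ 2 + 2 * ⟪v, y⟫ * t := by
  rw [norm_add_sq_real, real_inner_smul_right, real_inner_comm, norm_smul, mul_pow,
    Real.norm_eq_abs, sq_abs]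
  constructor <;> intro h <;> linarith

/-- In a stationary analogue-gravity flow with propagation speed
`c > ‖v‖` and flow velocity `v`, for every spatial displacement `y ≠ 0` the quantity
`T = (√((c² − ‖v‖²)·‖y‖² + ⟪v,y⟫²) + ⟪v,y⟫)/(c² − ‖v‖²)` is the unique positive
solution of the null condition `c²T² = ‖y + T•v‖²`, and it equals the Randers
expression `√(a(y,y)) + b(y)` with
`a(y,y) = ((c² − ‖v‖²)‖y‖² + ⟪v,y⟫²)/(c² − ‖v‖²)²` and `b(y) = ⟪v,y⟫/(c² − ‖v‖²)`. -/
theorem analogue_gravity_randers_travel_time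
    (n : ℕ) (hn : 1 ≤ n)
    (v : EuclideanSpace ℝ (Fin n)) (c : ℝ) (hc : ‖v‖ < c)
    (y : EuclideanSpace ℝ (Fin n)) (hy : y ≠ 0)
    (T : ℝ)
    (hT : T = (Real.sqrt ((c ^ 2 - ‖v‖ ^ 2) * ‖y‖ ^ 2 + ⟪v, y⟫ ^ 2) + ⟪v, y⟫) /
      (c ^ 2 - ‖v‖ ^ 2)) :
    0 < T ∧ c ^ 2 * T ^ 2 = ‖y + T • v‖ ^ 2 ∧
      (∀ T' : ℝ, 0 < T' → c ^ 2 * T' ^ 2 = ‖y + T' • v‖ ^ 2 → T' = T) ∧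
      T = Real.sqrt (((c ^ 2 - ‖v‖ ^ 2) * ‖y‖ ^ 2 + ⟪v, y⟫ ^ 2) / (c ^ 2 - ‖v‖ ^ 2) ^ 2) +
        ⟪v, y⟫ / (c ^ 2 - ‖v‖ ^ 2) := by
  have hk : 0 < c ^ 2 - ‖v‖ ^ 2 :=
    sub_pos.2 (pow_lt_pow_left₀ hc (norm_nonneg v) two_ne_zero)
  have hq : 0 < ‖y‖ ^ 2 := pow_pos (norm_pos_iff.2 hy) 2
  obtain ⟨hpos, hnull⟩ := (pos_and_quadratic_iff_eq hk hq).2 hT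
  refine ⟨hpos, (sq_mul_sq_eq_norm_add_smul_sq_iff v y c T).2 hnull, fun t ht h => ?_, ?_⟩
  · rw [hT]
    exact (pos_and_quadratic_iff_eq hk hq).1
      ⟨ht, (sq_mul_sq_eq_norm_add_smul_sq_iff v y c t).1 h⟩
  · rw [hT, Real.sqrt_div' _ (sq_nonneg _), Real.sqrt_sq hk.le, add_div]
end
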